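/- For every α ≥ 0 and every c > 0 there exists a finite constant C (depending only on α and c) such that for every dimension d ≥ 1 and every convex body K ⊂ ℝ^d with diameter at most 2c·d^α, the normalized random variable F_K = (dist²(X_K,K) − E[dist²(X_K,K)]) / √(Var(dist²(X_K,K))) satisfies d_TV(F_K, N) ≤ C·d^{α − 1/2}, where N is a standard Gaussian random variable. -/

import Mathlib

open MeasureTheory ProbabilityTheory Metric Real

/-- Total variation distance between two Borel measures on `ℝ`. -/
noncomputable def dTV (μ ν : Measure ℝ) : ℝ :=
  ⨆ A : {A : Set ℝ // MeasurableSet A}, |(μ (A : Set ℝ)).toReal - (ν (A : Set ℝ)).toReal|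

open scoped ENNReal

/-- One-dimensional Brunn–Minkowski inequality. -/
theorem volume_add_volume_le_of_add_mem {A B C : Set ℝ} (hA : MeasurableSet A)
    (hB : MeasurableSet B) (hA0 : A.Nonempty) (hB0 : B.Nonempty)
    (h : ∀ a ∈ A, ∀ b ∈ B, a + b ∈ C) : volume A + volume B ≤ volume C := by
  have key : ∀ S T : Set ℝ, IsCompact S → IsCompact T → S.Nonempty → T.Nonempty → S ⊆ A → T ⊆ B →
      volume S + volume T ≤ volume C := by
    intro S T hS hT hS0 hT0 hSA hTB
    obtain ⟨s, hs, hs'⟩ := hS.exists_isGreatest hS0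
    obtain ⟨t, ht, ht'⟩ := hT.exists_isLeast hT0
    have h1 : volume ((fun x => x + t) '' S) = volume S := by
      simp [Set.image_add_right]
    have h2 : volume ((fun x => s + x) '' T) = volume T := by
      simp [Set.image_add_left]
    rw [← h1, ← h2, ← measure_union₀]
    · apply measure_mono
      rintro _ (⟨x, hx, rfl⟩ | ⟨x, hx, rfl⟩)
      · exact h _ (hSA hx) _ (hTB ht)
      · exact h _ (hSA hs) _ (hTB hx)
    · exact (hT.image (by fun_prop)).measurableSet.nullMeasurableSet
    · refine measure_mono_null (t := {s + t}) ?_ (by simp)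
      rintro _ ⟨⟨x, hx, rfl⟩, ⟨y, hy, hxy⟩⟩
      have := hs' hx
      have := ht' hy
      simp only [Set.mem_singleton_iff] at *
      linarith
  obtain ⟨a, ha⟩ := hA0
  obtain ⟨b, hb⟩ := hB0
  rw [hA.measure_eq_iSup_isCompact, hB.measure_eq_iSup_isCompact]
  simp only [iSup_and']
  refine ENNReal.biSup_add_biSup_le' ⟨∅, by simp⟩ ⟨∅, by simp⟩ ?_
  rintro S ⟨hSA, hS⟩ T ⟨hTB, hT⟩
  refine (add_le_add (measure_mono (Set.subset_insert a S))
    (measure_mono (Set.subset_insert b T))).trans ?_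
  exact key _ _ (hS.insert a) (hT.insert b) ⟨a, by simp⟩ ⟨b, by simp⟩
    (Set.insert_subset ha hSA) (Set.insert_subset hb hTB)

theorem lintegral_add_lintegral_le_of_mul_le_sq {f g h : ℝ → ℝ} (hf : Measurable f)
    (hg : Measurable g) (hh : Measurable h) (hf0 : ∀ x, 0 ≤ f x) (hg0 : ∀ x, 0 ≤ g x)
    (hh0 : ∀ x, 0 ≤ h x) (hf1 : ∀ x, f x ≤ 1) (hg1 : ∀ x, g x ≤ 1)
    (hfs : ∀ t < 1, ∃ x, t < f x) (hgs : ∀ t < 1, ∃ x, t < g x)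
    (H : ∀ x y, f x * g y ≤ h (x + y) ^ 2) :
    (∫⁻ x, ENNReal.ofReal (f x)) + ∫⁻ x, ENNReal.ofReal (g x) ≤ ∫⁻ x, ENNReal.ofReal (h x) := by
  rw [lintegral_eq_lintegral_meas_lt volume (.of_forall hf0) hf.aemeasurable,
    lintegral_eq_lintegral_meas_lt volume (.of_forall hg0) hg.aemeasurable,
    lintegral_eq_lintegral_meas_lt volume (.of_forall hh0) hh.aemeasurable, ← lintegral_add_left]
  · refine setLIntegral_mono' measurableSet_Ioi fun t (ht : 0 < t) => ?_
    by_cases ht1 : t < 1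
    · refine volume_add_volume_le_of_add_mem (measurableSet_lt measurable_const hf)
        (measurableSet_lt measurable_const hg) (hfs t ht1) (hgs t ht1) ?_
      intro a (ha : t < f a) b (hb : t < g b)
      show t < h (a + b)
      refine lt_of_pow_lt_pow_left₀ 2 (hh0 _) (lt_of_lt_of_le ?_ (H a b))
      nlinarith
    · have h1 : {a | t < f a} = ∅ := by
        ext x; simpa using (hf1 x).trans (not_lt.1 ht1)
      have h2 : {a | t < g a} = ∅ := by
        ext x; simpa using (hg1 x).trans (not_lt.1 ht1)
      simp [h1, h2]
  · have : Antitone fun t => volume {a | t < f a} := by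
      intro s t hst
      exact measure_mono fun x (hx : t < f x) => lt_of_le_of_lt hst hx
    exact this.measurable

theorem ENNReal.four_mul_mul_le_add_sq (a b : ℝ≥0∞) : 4 * (a * b) ≤ (a + b) ^ 2 := by
  wlog hab : a ≤ b generalizing a b
  · rw [mul_comm a, add_comm a]
    exact this b a (le_of_not_ge hab)
  obtain ⟨e, rfl⟩ := exists_add_of_le hab
  have : (a + (a + e)) ^ 2 = 4 * (a * (a + e)) + e ^ 2 := by ring
  rw [this]
  exact le_self_add

theorem prekopa_leindler_real_of_le {f g h : ℝ → ℝ≥0∞} (hf : Measurable f) (hg : Measurable g)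
    (hh : Measurable h) {M : ℝ≥0∞} (hM : M ≠ ∞) (hfM : ∀ x, f x ≤ M) (hgM : ∀ x, g x ≤ M)
    (H : ∀ x y, f x * g y ≤ h (x + y) ^ 2) :
    4 * ((∫⁻ x, f x) * ∫⁻ x, g x) ≤ (∫⁻ x, h x) ^ 2 := by
  obtain ⟨a, ha⟩ : ∃ a, a = ⨆ x, f x := ⟨_, rfl⟩
  obtain ⟨b, hb⟩ : ∃ b, b = ⨆ x, g x := ⟨_, rfl⟩
  have hfa : ∀ x, f x ≤ a := fun x => ha ▸ le_iSup f x
  have hgb : ∀ x, g x ≤ b := fun x => hb ▸ le_iSup g x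
  have hat : a ≠ ∞ := ne_top_of_le_ne_top hM (ha ▸ iSup_le hfM)
  have hbt : b ≠ ∞ := ne_top_of_le_ne_top hM (hb ▸ iSup_le hgM)
  by_cases ha0 : a = 0
  · have : ∀ x, f x = 0 := fun x => le_antisymm ((hfa x).trans ha0.le) bot_le
    simp [this]
  by_cases hb0 : b = 0
  · have : ∀ x, g x = 0 := fun x => le_antisymm ((hgb x).trans hb0.le) bot_le
    simp [this]
  have ha' : 0 < a.toReal := ENNReal.toReal_pos ha0 hat
  have hb' : 0 < b.toReal := ENNReal.toReal_pos hb0 hbt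
  set r : ℝ := √(a.toReal * b.toReal) with hr
  have hr0 : 0 < r := by positivity
  have hr2 : r ^ 2 = a.toReal * b.toReal := Real.sq_sqrt (by positivity)
  have hft : ∀ x, f x ≠ ∞ := fun x => ne_top_of_le_ne_top hat (hfa x)
  have hgt : ∀ x, g x ≠ ∞ := fun x => ne_top_of_le_ne_top hbt (hgb x)
  have hmt : ∀ x, min (h x) (ENNReal.ofReal r) ≠ ∞ := fun x =>
    ne_top_of_le_ne_top ENNReal.ofReal_ne_top (min_le_right _ _)
  have exists_lt : ∀ (u : ℝ → ℝ≥0∞) (s : ℝ≥0∞), s = ⨆ x, u x → 0 < s.toReal → s ≠ ∞ →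
      ∀ t < 1, ∃ x, t < (u x).toReal / s.toReal := by
    intro u s hs hs0 hst t ht
    have : ENNReal.ofReal (max t 0 * s.toReal) < ⨆ x, u x := by
      rw [← hs, ENNReal.ofReal_lt_iff_lt_toReal (by positivity) hst]
      have := max_lt ht one_pos
      nlinarith
    obtain ⟨x, hx⟩ := lt_iSup_iff.1 this
    have hxt : u x ≠ ∞ := ne_top_of_le_ne_top hst (hs ▸ le_iSup u x)
    refine ⟨x, lt_of_le_of_lt (le_max_left t 0) ?_⟩
    rw [lt_div_iff₀ hs0]
    exact (ENNReal.ofReal_lt_iff_lt_toReal (by positivity) hxt).1 hx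
  have key := lintegral_add_lintegral_le_of_mul_le_sq
    (f := fun x => (f x).toReal / a.toReal) (g := fun x => (g x).toReal / b.toReal)
    (h := fun x => (min (h x) (ENNReal.ofReal r)).toReal / r)
    (by fun_prop) (by fun_prop) (by fun_prop) (fun x => by positivity) (fun x => by positivity)
    (fun x => by positivity)
    (fun x => div_le_one_of_le₀ (ENNReal.toReal_mono hat (hfa x)) ha'.le)
    (fun x => div_le_one_of_le₀ (ENNReal.toReal_mono hbt (hgb x)) hb'.le)
    (exists_lt f a ha ha' hat) (exists_lt g b hb hb' hbt)
    (fun x y => by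
      have h1 : f x * g y ≤ (min (h (x + y)) (ENNReal.ofReal r)) ^ 2 := by
        rcases le_total (h (x + y)) (ENNReal.ofReal r) with h2 | h2
        · rw [min_eq_left h2]; exact H x y
        · rw [min_eq_right h2, ← ENNReal.ofReal_pow hr0.le, hr2, ENNReal.ofReal_mul ha'.le,
            ENNReal.ofReal_toReal hat, ENNReal.ofReal_toReal hbt]
          exact mul_le_mul' (hfa x) (hgb y)
      have h3 := ENNReal.toReal_mono (ENNReal.pow_ne_top (hmt _)) h1
      rw [ENNReal.toReal_mul, ENNReal.toReal_pow] at h3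
      rw [div_mul_div_comm, div_pow, hr2]
      gcongr)
  have e1 : ∀ (u : ℝ → ℝ≥0∞) (s : ℝ), 0 < s → (∀ x, u x ≠ ∞) → Measurable u →
      ∫⁻ x, u x = ENNReal.ofReal s * ∫⁻ x, ENNReal.ofReal ((u x).toReal / s) := by
    intro u s hs hu hum
    rw [← lintegral_const_mul _ (by fun_prop)]
    refine lintegral_congr fun x => ?_
    rw [← ENNReal.ofReal_mul hs.le, mul_div_cancel₀ _ hs.ne', ENNReal.ofReal_toReal (hu x)]
  have e2 := e1 f _ ha' hft hf
  have e3 := e1 g _ hb' hgt hg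
  have e4 := e1 _ _ hr0 hmt (hh.min measurable_const)
  set F := ∫⁻ x, ENNReal.ofReal ((f x).toReal / a.toReal)
  set G := ∫⁻ x, ENNReal.ofReal ((g x).toReal / b.toReal)
  calc 4 * ((∫⁻ x, f x) * ∫⁻ x, g x) = ENNReal.ofReal r ^ 2 * (4 * (F * G)) := by
        rw [e2, e3, ← ENNReal.ofReal_pow hr0.le, hr2, ENNReal.ofReal_mul ha'.le]; ring
    _ ≤ ENNReal.ofReal r ^ 2 * (F + G) ^ 2 := by
        gcongr; exact ENNReal.four_mul_mul_le_add_sq F G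
    _ ≤ (∫⁻ x, min (h x) (ENNReal.ofReal r)) ^ 2 := by
        rw [e4, mul_pow]; gcongr
    _ ≤ (∫⁻ x, h x) ^ 2 := by
        gcongr with x; exact min_le_left _ _

theorem prekopa_leindler_real {f g h : ℝ → ℝ≥0∞} (hf : Measurable f) (hg : Measurable g)
    (hh : Measurable h) (H : ∀ x y, f x * g y ≤ h (x + y) ^ 2) :
    4 * ((∫⁻ x, f x) * ∫⁻ x, g x) ≤ (∫⁻ x, h x) ^ 2 := by
  have key : ∀ u : ℝ → ℝ≥0∞, Measurable u →
      ∫⁻ x, u x = ⨆ n : ℕ, ∫⁻ x, min (u x) n := by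
    intro u hu
    rw [← lintegral_iSup (fun n => hu.min measurable_const)]
    · refine lintegral_congr fun x => ?_
      rw [← inf_iSup_eq, ENNReal.iSup_natCast, inf_top_eq]
    · intro m n hmn x
      exact min_le_min_left _ (by exact_mod_cast hmn)
  have mono : ∀ u : ℝ → ℝ≥0∞, Monotone fun n : ℕ => ∫⁻ x, min (u x) n := by
    intro u m n hmn
    exact lintegral_mono fun x => min_le_min_left _ (by exact_mod_cast hmn)
  rw [key f hf, key g hg, ENNReal.iSup_mul, ENNReal.mul_iSup]
  refine iSup_le fun i => ?_
  rw [ENNReal.mul_iSup, ENNReal.mul_iSup]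
  refine iSup_le fun j => ?_
  set n := max i j
  refine (mul_le_mul_right (mul_le_mul' (mono f (le_max_left i j)) (mono g (le_max_right i j)))
    4).trans ?_
  refine prekopa_leindler_real_of_le (hf.min measurable_const) (hg.min measurable_const) hh
    (ENNReal.natCast_ne_top n) (fun x => min_le_right _ _) (fun x => min_le_right _ _) fun x y => ?_
  exact (mul_le_mul' (min_le_left _ _) (min_le_left _ _)).trans (H x y)

/-- The Prékopa–Leindler inequality with weight `1 / 2`, written with `x + y` in place of the
midpoint. -/
theorem prekopa_leindler_pi : ∀ (n : ℕ) {f g h : (Fin n → ℝ) → ℝ≥0∞}, Measurable f → Measurable g →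
    Measurable h → (∀ x y, f x * g y ≤ h (x + y) ^ 2) →
    4 ^ n * ((∫⁻ x, f x) * ∫⁻ x, g x) ≤ (∫⁻ x, h x) ^ 2
  | 0, f, g, h, hf, hg, hh, H => by
    have h0 : ∀ u : (Fin 0 → ℝ) → ℝ≥0∞, ∫⁻ x, u x = u 0 := fun u => by
      rw [lintegral_unique, volume_pi, Measure.pi_empty_univ, mul_one]
      exact congrArg u (Subsingleton.elim _ _)
    simpa [h0] using H 0 0
  | n + 1, f, g, h, hf, hg, hh, H => by
    let e := (MeasurableEquiv.piFinSuccAbove (fun _ : Fin (n + 1) => ℝ) 0).symm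
    have he : MeasurePreserving e :=
      (volume_preserving_piFinSuccAbove (fun _ : Fin (n + 1) => ℝ) 0).symm
    have hadd : ∀ a b : ℝ, ∀ x y : Fin n → ℝ, e (a, x) + e (b, y) = e (a + b, x + y) := by
      intro a b x y
      funext i
      refine Fin.cases ?_ (fun j => ?_) i <;> simp [e, MeasurableEquiv.piFinSuccAbove]
    have split : ∀ u : (Fin (n + 1) → ℝ) → ℝ≥0∞, Measurable u →
        ∫⁻ x, u x = ∫⁻ x : Fin n → ℝ, ∫⁻ t : ℝ, u (e (t, x)) := by
      intro u hu
      rw [← he.lintegral_comp_emb e.measurableEmbedding, Measure.volume_eq_prod,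
        lintegral_prod_symm _ (by fun_prop)]
    have meas : ∀ u : (Fin (n + 1) → ℝ) → ℝ≥0∞, Measurable u →
        Measurable fun x : Fin n → ℝ => ∫⁻ t : ℝ, u (e (t, x)) := by
      intro u hu
      exact Measurable.lintegral_prod_left' (f := fun p : ℝ × (Fin n → ℝ) => u (e p)) (by fun_prop)
    rw [split f hf, split g hg, split h hh]
    have := prekopa_leindler_pi n (f := fun x => 4 * ∫⁻ t : ℝ, f (e (t, x)))
      ((meas f hf).const_mul 4) (meas g hg) (meas h hh) fun x y => by
        rw [mul_assoc]
        refine prekopa_leindler_real (by fun_prop) (by fun_prop) (by fun_prop) fun a b => ?_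
        rw [← hadd]
        exact H _ _
    rw [lintegral_const_mul _ (meas f hf)] at this
    calc _ = _ := by ring
      _ ≤ _ := this

theorem prekopa_leindler_euclideanSpace {n : ℕ} {f g h : EuclideanSpace ℝ (Fin n) → ℝ≥0∞}
    (hf : Measurable f) (hg : Measurable g) (hh : Measurable h)
    (H : ∀ x y, f x * g y ≤ h (midpoint ℝ x y) ^ 2) :
    (∫⁻ x, f x) * ∫⁻ x, g x ≤ (∫⁻ x, h x) ^ 2 := by
  have he := PiLp.volume_preserving_toLp (Fin n)
  have hcomp : ∀ u : EuclideanSpace ℝ (Fin n) → ℝ≥0∞,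
      ∫⁻ x, u (WithLp.toLp 2 x) = ∫⁻ x, u x := fun u =>
    he.lintegral_comp_emb (MeasurableEquiv.toLp 2 _).measurableEmbedding u
  have := prekopa_leindler_pi n (f := fun x => f (WithLp.toLp 2 x))
    (g := fun x => g (WithLp.toLp 2 x))
    (h := fun x => h (WithLp.toLp 2 ((1 / 2 : ℝ) • x))) (by fun_prop) (by fun_prop) (by fun_prop)
    fun x y => by
      convert H (WithLp.toLp 2 x) (WithLp.toLp 2 y) using 3
      rw [midpoint_eq_smul_add]
      ext i
      simp [mul_add]
  have hscale : ∫⁻ x : Fin n → ℝ, h (WithLp.toLp 2 ((1 / 2 : ℝ) • x)) = 2 ^ n * ∫⁻ x, h x := by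
    have hm : Measurable fun x : Fin n → ℝ => h (WithLp.toLp 2 x) := by fun_prop
    rw [← lintegral_map (f := fun x : Fin n → ℝ => h (WithLp.toLp 2 x))
      (g := fun x => (1 / 2 : ℝ) • x) hm (by fun_prop),
      Measure.map_addHaar_smul _ (by norm_num), lintegral_smul_measure, hcomp]
    simp [ENNReal.ofReal_pow]
  rw [hcomp, hcomp, hscale, mul_pow, ← pow_mul, mul_comm n, pow_mul] at this
  norm_num at this
  exact (ENNReal.mul_le_mul_iff_right (by simp) (by simp)).1 this

theorem mul_integral_Ioi_exp_neg_sq_le (x : ℝ) :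
    x * ∫ t in Set.Ioi x, rexp (-(t ^ 2 / 2)) ≤ rexp (-(x ^ 2 / 2)) := by
  have h1 : Integrable fun t : ℝ => rexp (-(t ^ 2 / 2)) := by
    simpa [neg_div, div_eq_inv_mul] using integrable_exp_neg_mul_sq (b := 1 / 2) (by norm_num)
  have h2 : Integrable fun t : ℝ => t * rexp (-(t ^ 2 / 2)) := by
    simpa [neg_div, div_eq_inv_mul] using integrable_mul_exp_neg_mul_sq (b := 1 / 2) (by norm_num)
  have h3 : ∫ t in Set.Ioi x, t * rexp (-(t ^ 2 / 2)) = 0 - -rexp (-(x ^ 2 / 2)) := by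
    refine integral_Ioi_of_hasDerivAt_of_tendsto' (f := fun t => -rexp (-(t ^ 2 / 2)))
      (fun t _ => ?_) h2.integrableOn ?_
    · have : HasDerivAt (fun t : ℝ => -(t ^ 2 / 2)) (-t) t := by
        convert! ((hasDerivAt_pow 2 t).div_const 2).neg using 1
        simp
      convert! this.exp.neg using 1
      ring
    · have h4 : Filter.Tendsto (fun t : ℝ => t ^ 2 / 2) Filter.atTop Filter.atTop :=
        (Filter.tendsto_pow_atTop two_ne_zero).atTop_div_const two_pos
      simpa using (Real.tendsto_exp_neg_atTop_nhds_zero.comp h4).neg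
  rw [zero_sub, neg_neg] at h3
  rw [← h3, ← integral_const_mul]
  refine setIntegral_mono_on (h1.integrableOn.const_mul x) h2.integrableOn measurableSet_Ioi ?_
  intro t (ht : x < t)
  gcongr

theorem exp_mul_integral_Ioi_exp_neg_sq_le {x : ℝ} (hx : 0 ≤ x) :
    rexp (x ^ 2 / 2) * ∫ t in Set.Ioi x, rexp (-(t ^ 2 / 2)) ≤ 9 := by
  have h1 : Integrable fun t : ℝ => rexp (-(t ^ 2 / 2)) := by
    simpa [neg_div, div_eq_inv_mul] using integrable_exp_neg_mul_sq (b := 1 / 2) (by norm_num)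
  have h0 : 0 ≤ ∫ t in Set.Ioi x, rexp (-(t ^ 2 / 2)) := integral_nonneg fun t => by positivity
  rcases le_total 1 x with hx1 | hx1
  · have h2 := mul_integral_Ioi_exp_neg_sq_le x
    have h3 : rexp (x ^ 2 / 2) * rexp (-(x ^ 2 / 2)) = 1 := by simp [← Real.exp_add]
    have h4 : 0 < rexp (x ^ 2 / 2) := by positivity
    nlinarith
  · have h2 : ∫ t in Set.Ioi x, rexp (-(t ^ 2 / 2)) ≤ 3 := by
      calc _ ≤ ∫ t, rexp (-(t ^ 2 / 2)) :=
            setIntegral_le_integral h1 (.of_forall fun t => by positivity)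
        _ = √(π / (1 / 2)) := by
            rw [← integral_gaussian]; simp [div_eq_inv_mul]
        _ ≤ 3 := by
            rw [Real.sqrt_le_left (by norm_num)]; linarith [Real.pi_lt_four]
    have h3 : rexp (x ^ 2 / 2) ≤ 3 := by
      calc _ ≤ rexp 1 := by gcongr; nlinarith
        _ ≤ 3 := Real.exp_one_lt_d9.le.trans (by norm_num)
    nlinarith [Real.exp_pos (x ^ 2 / 2)]

/-- Solution of the Stein equation for a continuous test function with values in `[0, 1]`. -/
theorem exists_stein_solution {h : ℝ → ℝ} (hc : Continuous h) (h0 : ∀ x, 0 ≤ h x)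
    (h1 : ∀ x, h x ≤ 1) :
    ∃ g g' : ℝ → ℝ, (∀ x, HasDerivAt g (g' x) x) ∧ Continuous g' ∧ (∀ x, |g x| ≤ 9) ∧
      (∀ x, |g' x| ≤ 2) ∧ ∀ x, g' x - x * g x = h x - ∫ y, h y ∂gaussianReal 0 1 := by
  set c := ∫ y, h y ∂gaussianReal 0 1 with hcdef
  have hint : Integrable h (gaussianReal 0 1) :=
    Integrable.of_bound hc.aestronglyMeasurable 1
      (.of_forall fun x => by rw [Real.norm_eq_abs, abs_le]; constructor <;> linarith [h0 x, h1 x])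
  have hc0 : 0 ≤ c := integral_nonneg h0
  have hc1 : c ≤ 1 := by
    simpa using integral_mono hint (integrable_const (1 : ℝ)) h1
  have hhc : ∀ x, |h x - c| ≤ 1 := fun x => by
    rw [abs_le]; constructor <;> linarith [h0 x, h1 x]
  set φ : ℝ → ℝ := fun t => (h t - c) * rexp (-(t ^ 2 / 2)) with hφ
  have hφc : Continuous φ := by fun_prop
  have he : Integrable fun t : ℝ => rexp (-(t ^ 2 / 2)) := by
    simpa [neg_div, div_eq_inv_mul] using integrable_exp_neg_mul_sq (b := 1 / 2) (by norm_num)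
  have hφb : ∀ t, ‖φ t‖ ≤ rexp (-(t ^ 2 / 2)) := fun t => by
    rw [hφ, norm_mul, Real.norm_eq_abs, Real.norm_eq_abs, Real.abs_exp]
    exact mul_le_of_le_one_left (by positivity) (hhc t)
  have hφi : Integrable φ := he.mono' hφc.aestronglyMeasurable (.of_forall hφb)
  have hφ0 : ∫ t, φ t = 0 := by
    have e1 : ∫ y, (h y - c) ∂gaussianReal 0 1 = 0 := by
      rw [integral_sub hint (integrable_const c)]; simp [← hcdef]
    rw [integral_gaussianReal_eq_integral_smul (by simp)] at e1
    have e2 : ∀ t, gaussianPDFReal 0 1 t • (h t - c) = (√(2 * π))⁻¹ * φ t := by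
      intro t
      simp [gaussianPDFReal_def, hφ, neg_div]
      ring
    simp_rw [e2, integral_const_mul] at e1
    exact (mul_eq_zero.1 e1).resolve_left (by positivity)
  have hIoi : ∀ x, ∫ t in Set.Iic x, φ t = -∫ t in Set.Ioi x, φ t := by
    intro x
    have := intervalIntegral.integral_Iic_add_Ioi (b := x) hφi.integrableOn hφi.integrableOn
    linarith
  have hbIoi : ∀ x, |∫ t in Set.Ioi x, φ t| ≤ ∫ t in Set.Ioi x, rexp (-(t ^ 2 / 2)) := fun x =>
    norm_integral_le_of_norm_le he.integrableOn (.of_forall hφb)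
  have hbIic : ∀ x, |∫ t in Set.Iic x, φ t| ≤ ∫ t in Set.Ioi (-x), rexp (-(t ^ 2 / 2)) := by
    intro x
    have := integral_comp_neg_Iic x fun t => rexp (-(t ^ 2 / 2))
    rw [← this]
    simp only [neg_sq]
    exact norm_integral_le_of_norm_le he.integrableOn (.of_forall hφb)
  have hb : ∀ x, |∫ t in Set.Iic x, φ t| ≤ ∫ t in Set.Ioi |x|, rexp (-(t ^ 2 / 2)) := by
    intro x
    rcases le_total 0 x with hx | hx
    · rw [abs_of_nonneg hx, hIoi, abs_neg]; exact hbIoi x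
    · rw [abs_of_nonpos hx]; exact hbIic x
  set g : ℝ → ℝ := fun x => rexp (x ^ 2 / 2) * ∫ t in Set.Iic x, φ t with hg
  have hgb : ∀ x, |g x| ≤ 9 := by
    intro x
    rw [hg, abs_mul, Real.abs_exp, ← sq_abs x]
    exact (mul_le_mul_of_nonneg_left (hb x) (by positivity)).trans
      (exp_mul_integral_Ioi_exp_neg_sq_le (abs_nonneg x))
  have hxg : ∀ x, |x * g x| ≤ 1 := by
    intro x
    rw [hg, abs_mul, abs_mul, Real.abs_exp, ← sq_abs x]
    calc _ ≤ |x| * (rexp (|x| ^ 2 / 2) * ∫ t in Set.Ioi |x|, rexp (-(t ^ 2 / 2))) := by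
          gcongr; exact hb x
      _ = rexp (|x| ^ 2 / 2) * (|x| * ∫ t in Set.Ioi |x|, rexp (-(t ^ 2 / 2))) := by ring
      _ ≤ rexp (|x| ^ 2 / 2) * rexp (-(|x| ^ 2 / 2)) := by
          gcongr; exact mul_integral_Ioi_exp_neg_sq_le |x|
      _ = 1 := by simp [← Real.exp_add]
  have hgd : ∀ x, HasDerivAt g (x * g x + (h x - c)) x := by
    intro x
    have d1 : HasDerivAt (fun x => ∫ t in Set.Iic x, φ t) (φ x) x := by
      have : (fun x => ∫ t in Set.Iic x, φ t) =
          fun x => (∫ t in Set.Iic 0, φ t) + ∫ t in (0)..x, φ t := by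
        funext y
        rw [← intervalIntegral.integral_Iic_sub_Iic hφi.integrableOn hφi.integrableOn]
        ring
      rw [this]
      exact (hφc.integral_hasStrictDerivAt 0 x).hasDerivAt.const_add _
    have d2 : HasDerivAt (fun x : ℝ => rexp (x ^ 2 / 2)) (rexp (x ^ 2 / 2) * x) x := by
      have : HasDerivAt (fun t : ℝ => t ^ 2 / 2) x x := by
        convert! (hasDerivAt_pow 2 x).div_const 2 using 1
        simp
      exact this.exp
    convert! d2.mul d1 using 1
    have : rexp (x ^ 2 / 2) * rexp (-(x ^ 2 / 2)) = 1 := by simp [← Real.exp_add]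
    simp only [hg, hφ]
    linear_combination (-(h x - c)) * this
  have hgc : Continuous g := continuous_iff_continuousAt.2 fun x => (hgd x).continuousAt
  refine ⟨g, fun x => x * g x + (h x - c), hgd, by fun_prop, hgb, fun x => ?_, fun x => by ring⟩
  calc |x * g x + (h x - c)| ≤ |x * g x| + |h x - c| := abs_add_le _ _
    _ ≤ 2 := by linarith [hxg x, hhc x]

theorem measureReal_le_add_of_forall_continuous {μ ν : Measure ℝ} [IsProbabilityMeasure μ]
    [IsProbabilityMeasure ν] {ε : ℝ}
    (H : ∀ h : ℝ → ℝ, Continuous h → (∀ x, 0 ≤ h x) → (∀ x, h x ≤ 1) →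
      ∫ x, h x ∂μ ≤ ∫ x, h x ∂ν + ε) {A : Set ℝ} (hA : MeasurableSet A) :
    μ.real A ≤ ν.real A + ε := by
  have closed : ∀ F : Set ℝ, IsClosed F → μ.real F ≤ ν.real F + ε := by
    intro F hF
    have lim : ∀ (ρ : Measure ℝ) [IsProbabilityMeasure ρ],
        Filter.Tendsto (fun n => ∫ x, (hF.apprSeq n x : ℝ) ∂ρ) Filter.atTop (nhds (ρ.real F)) := by
      intro ρ _
      have := (ENNReal.tendsto_toReal (measure_ne_top ρ F)).comp
        (HasOuterApproxClosed.tendsto_lintegral_apprSeq hF ρ)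
      refine this.congr fun n => ?_
      exact BoundedContinuousFunction.toReal_lintegral_coe_eq_integral _ _
    refine le_of_tendsto_of_tendsto' (lim μ) ((lim ν).add_const ε) fun n => H _ (by fun_prop)
      (fun x => NNReal.coe_nonneg _) fun x => ?_
    exact_mod_cast HasOuterApproxClosed.apprSeq_apply_le_one hF n x
  refine le_of_forall_pos_le_add fun δ hδ => ?_
  obtain ⟨F, hFA, hF, hlt⟩ := hA.exists_isClosed_lt_add (μ := μ) (measure_ne_top μ A)
    (ENNReal.ofReal_pos.2 hδ).ne'
  have h1 : μ.real A ≤ μ.real F + δ := by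
    have := ENNReal.toReal_mono (by finiteness) hlt.le
    rwa [ENNReal.toReal_add (by finiteness) (by finiteness), ENNReal.toReal_ofReal hδ.le] at this
  have h2 : ν.real F ≤ ν.real A := measureReal_mono hFA
  linarith [closed F hF]

theorem abs_measureReal_sub_le_of_forall_continuous {μ ν : Measure ℝ} [IsProbabilityMeasure μ]
    [IsProbabilityMeasure ν] {ε : ℝ}
    (H : ∀ h : ℝ → ℝ, Continuous h → (∀ x, 0 ≤ h x) → (∀ x, h x ≤ 1) →
      |∫ x, h x ∂μ - ∫ x, h x ∂ν| ≤ ε) {A : Set ℝ} (hA : MeasurableSet A) :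
    |μ.real A - ν.real A| ≤ ε := by
  rw [abs_le]
  constructor
  · linarith [measureReal_le_add_of_forall_continuous (μ := ν) (ν := μ) (ε := ε)
      (fun h h1 h2 h3 => by linarith [(abs_le.1 (H h h1 h2 h3)).1]) hA]
  · linarith [measureReal_le_add_of_forall_continuous (μ := μ) (ν := ν) (ε := ε)
      (fun h h1 h2 h3 => by linarith [(abs_le.1 (H h h1 h2 h3)).2]) hA]

theorem integral_abs_mul_le_of_integral_sq_le {Ω : Type*} [MeasurableSpace Ω] {P : Measure Ω}
    {X Y : Ω → ℝ} (hX : MemLp X 2 P) (hY : MemLp Y 2 P) {s t : ℝ} (hs : 0 ≤ s) (ht : 0 ≤ t)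
    (hXs : ∫ ω, X ω ^ 2 ∂P ≤ s ^ 2) (hYt : ∫ ω, Y ω ^ 2 ∂P ≤ t ^ 2) :
    ∫ ω, |X ω * Y ω| ∂P ≤ s * t := by
  have hXY : Integrable (fun ω => |X ω * Y ω|) P := (hX.integrable_mul hY).abs
  have hX2 := hX.integrable_sq
  have hY2 := hY.integrable_sq
  have key : ∀ x : ℝ, 0 ≤ (∫ ω, Y ω ^ 2 ∂P) * (x * x) + (2 * ∫ ω, |X ω * Y ω| ∂P) * x +
      ∫ ω, X ω ^ 2 ∂P := by
    intro x
    rw [← integral_mul_const, ← integral_const_mul, ← integral_mul_const, ← integral_add,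
      ← integral_add]
    · refine integral_nonneg fun ω => ?_
      have := sq_nonneg (|X ω| + x * |Y ω|)
      rw [add_sq, mul_pow, sq_abs, sq_abs] at this
      simp only [Pi.zero_apply, abs_mul]
      linarith
    · exact (hY2.mul_const _).add ((hXY.const_mul 2).mul_const x)
    · exact hX2
    · exact hY2.mul_const _
    · exact (hXY.const_mul 2).mul_const x
  have h := discrim_le_zero key
  rw [discrim] at h
  have h2 : (∫ ω, X ω ^ 2 ∂P) * (∫ ω, Y ω ^ 2 ∂P) ≤ s ^ 2 * t ^ 2 := by
    gcongr
  refine abs_le_of_sq_le_sq' ?_ (by positivity) |>.2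
  linarith

set_option maxHeartbeats 1000000 in
/-- Quantitative central limit theorem for a random variable `D` satisfying a Stein identity
whose defect is governed by a random variable `w` of small variance. -/
theorem abs_integral_sub_gaussian_le {Ω : Type*} [MeasurableSpace Ω] {P : Measure Ω}
    [IsProbabilityMeasure P] {D w : Ω → ℝ} (hD : Measurable D) (hD2 : MemLp D 2 P)
    (hw2 : MemLp w 2 P) {d : ℝ} (hd : 0 < d) {s : ℝ} (hs : 0 ≤ s)
    (hws : variance w P ≤ s ^ 2)
    (hA : ∀ f f' : ℝ → ℝ, (∀ x, HasDerivAt f (f' x) x) → Continuous f' →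
      (∃ B, ∀ x, |f' x| ≤ B) → 2 * π * ∫ ω, (D ω + w ω) * f (D ω) ∂P =
        d * ∫ ω, f (D ω) ∂P + 2 * ∫ ω, f' (D ω) * (D ω + w ω) ∂P)
    {h : ℝ → ℝ} (hc : Continuous h) (h0 : ∀ x, 0 ≤ h x) (h1 : ∀ x, h x ≤ 1) :
    |(∫ ω, h ((D ω - ∫ ω', D ω' ∂P) / √(variance D P)) ∂P) - ∫ y, h y ∂gaussianReal 0 1| ≤
      88 * (1 + s) / √d := by
  obtain ⟨m, hm⟩ : ∃ m, m = ∫ ω, D ω ∂P := ⟨_, rfl⟩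
  obtain ⟨n, hn⟩ : ∃ n, n = ∫ ω, w ω ∂P := ⟨_, rfl⟩
  obtain ⟨σ, hσ⟩ : ∃ σ, σ = √(variance D P) := ⟨_, rfl⟩
  rw [← hm, ← hσ]
  have hσ0 : 0 ≤ σ := hσ ▸ Real.sqrt_nonneg _
  have hσ2 : σ ^ 2 = ∫ ω, (D ω - m) ^ 2 ∂P := by
    rw [hσ, Real.sq_sqrt (variance_nonneg _ _), variance_eq_integral hD.aemeasurable, hm]
  have hD1 : Integrable D P := hD2.integrable one_le_two
  have hw1 : Integrable w P := hw2.integrable one_le_two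
  have hU : MemLp (fun ω => D ω - m) 2 P := hD2.sub (memLp_const m)
  have hV : MemLp (fun ω => w ω - n) 2 P := hw2.sub (memLp_const n)
  have hU1 := hU.integrable one_le_two
  have hV1 := hV.integrable one_le_two
  have hVs : ∫ ω, (w ω - n) ^ 2 ∂P ≤ s ^ 2 := by
    rwa [variance_eq_integral hw2.1.aemeasurable, ← hn] at hws
  have hVE : ∫ ω, |w ω - n| ∂P ≤ s := by
    simpa using integral_abs_mul_le_of_integral_sq_le hV (memLp_const (1 : ℝ)) hs zero_le_one hVs
      (by simp)
  have hUE : ∫ ω, |D ω - m| ∂P ≤ σ := by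
    simpa using integral_abs_mul_le_of_integral_sq_le hU (memLp_const (1 : ℝ)) hσ0 zero_le_one
      hσ2.ge (by simp)
  have hVUi : Integrable (fun ω => (w ω - n) * (D ω - m)) P := hV.integrable_mul hU
  have hUVi : Integrable (fun ω => |D ω - m| + |w ω - n|) P := hU1.abs.add hV1.abs
  have hVU : |∫ ω, (w ω - n) * (D ω - m) ∂P| ≤ s * σ :=
    (abs_integral_le_integral_abs).trans
      (integral_abs_mul_le_of_integral_sq_le hV hU hs hσ0 hVs hσ2.ge)
  have hS : Integrable (fun ω => D ω + w ω) P := hD1.add hw1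
  have hES : 2 * π * (m + n) = d := by
    have := hA (fun _ => 1) (fun _ => 0) (fun x => hasDerivAt_const x 1) continuous_const
      ⟨0, by simp⟩
    simp only [mul_one, zero_mul, integral_zero, mul_zero, add_zero, integral_const] at this
    rw [integral_add hD1 hw1, ← hm, ← hn] at this
    simpa using this
  have hUz : ∫ ω, (D ω - m) ∂P = 0 := by
    rw [integral_sub hD1 (integrable_const _)]; simp [hm]
  have hvar : 2 * π ^ 2 * (σ ^ 2 + ∫ ω, (w ω - n) * (D ω - m) ∂P) = d := by
    have := hA (fun x => x - m) (fun _ => 1) (fun x => (hasDerivAt_id x).sub_const m)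
      continuous_const ⟨1, by simp⟩
    simp only [one_mul, hUz, mul_zero, zero_add] at this
    rw [integral_add hD1 hw1, ← hm, ← hn] at this
    have e : ∫ ω, (D ω + w ω) * (D ω - m) ∂P =
        ∫ ω, (D ω - m) ^ 2 ∂P + ∫ ω, (w ω - n) * (D ω - m) ∂P := by
      have : ∀ ω, (D ω + w ω) * (D ω - m) =
          (D ω - m) ^ 2 + (w ω - n) * (D ω - m) + (m + n) * (D ω - m) := fun ω => by ring
      simp_rw [this]
      rw [integral_add, integral_add hU.integrable_sq hVUi, integral_const_mul,
        hUz, mul_zero, add_zero]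
      · exact hU.integrable_sq.add hVUi
      · exact hU1.const_mul _
    rw [e, ← hσ2] at this
    linear_combination π * this + hES
  obtain ⟨κ, hκ⟩ : ∃ κ, κ = ∫ ω, (w ω - n) * (D ω - m) ∂P := ⟨_, rfl⟩
  rw [← hκ] at hvar hVU
  have hd' : 0 < √d := Real.sqrt_pos.2 hd
  have hdd : √d ^ 2 = d := Real.sq_sqrt hd.le
  have hπ := Real.pi_pos
  have hsd : √d ≤ 2 * π * max s σ := by
    refine abs_le_of_sq_le_sq' ?_ (by positivity) |>.2
    have h3 : κ ≤ s * σ := (abs_le.1 hVU).2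
    have h4 : σ ^ 2 + κ ≤ 2 * max s σ ^ 2 := by
      have := mul_le_mul (le_max_left s σ) (le_max_right s σ) hσ0 (hs.trans (le_max_left s σ))
      have := pow_le_pow_left₀ hσ0 (le_max_right s σ) 2
      linarith
    calc √d ^ 2 = 2 * π ^ 2 * (σ ^ 2 + κ) := by rw [hdd, hvar]
      _ ≤ 2 * π ^ 2 * (2 * max s σ ^ 2) := by gcongr
      _ = _ := by ring
  set F : Ω → ℝ := fun ω => (D ω - m) / σ with hF
  have hFm : Measurable F := by fun_prop
  obtain ⟨g, g', hg, hg'c, hgb, hg'b, heq⟩ := exists_stein_solution hc h0 h1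
  have hgc : Continuous g := continuous_iff_continuousAt.2 fun x => (hg x).continuousAt
  set c := ∫ y, h y ∂gaussianReal 0 1 with hcdef
  have hhi : Integrable (fun ω => h (F ω)) P :=
    Integrable.of_bound (hc.measurable.comp hFm).aestronglyMeasurable 1
      (.of_forall fun x => by
        rw [Real.norm_eq_abs, abs_le]; constructor <;> linarith [h0 (F x), h1 (F x)])
  rcases lt_or_ge σ s with hlt | hle
  · rw [max_eq_left hlt.le] at hsd
    have hgi : Integrable h (gaussianReal 0 1) :=
      Integrable.of_bound hc.aestronglyMeasurable 1
        (.of_forall fun x => by rw [Real.norm_eq_abs, abs_le]; constructor <;> linarith [h0 x, h1 x])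
    have b1 : 0 ≤ ∫ ω, h (F ω) ∂P := integral_nonneg fun ω => h0 _
    have b2 : ∫ ω, h (F ω) ∂P ≤ 1 := by
      simpa using integral_mono hhi (integrable_const (1 : ℝ)) fun ω => h1 _
    have b3 : 0 ≤ c := integral_nonneg h0
    have b4 : c ≤ 1 := by simpa using integral_mono hgi (integrable_const (1 : ℝ)) h1
    have b5 : 1 ≤ 88 * (1 + s) / √d := by
      rw [one_le_div hd']
      nlinarith [Real.pi_lt_four]
    rw [abs_le]
    constructor <;> linarith
  rw [max_eq_right hle] at hsd
  have hσp : 0 < σ := by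
    by_contra! hcon
    have : σ = 0 := le_antisymm hcon hσ0
    rw [this] at hsd
    linarith
  have bdd : ∀ {q : ℝ → ℝ} {B : ℝ} {Y : Ω → ℝ}, Continuous q → (∀ x, |q x| ≤ B) →
      Integrable Y P → Integrable (fun ω => q (F ω) * Y ω) P := fun {q B Y} hq hB hY =>
    hY.bdd_mul (c := B) (hq.measurable.comp hFm).aestronglyMeasurable (.of_forall fun ω => hB _)
  have stein := hA (fun t => g ((t - m) / σ)) (fun t => g' ((t - m) / σ) / σ)
    (fun x => by
      have : HasDerivAt (fun t => (t - m) / σ) (1 / σ) x :=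
        ((hasDerivAt_id x).sub_const m).div_const σ
      convert! (hg ((x - m) / σ)).comp x this using 1
      ring) (by fun_prop) ⟨2 / σ, fun x => by
        rw [abs_div, abs_of_pos hσp]
        gcongr
        exact hg'b _⟩
  change 2 * π * ∫ ω, (D ω + w ω) * g (F ω) ∂P =
    d * ∫ ω, g (F ω) ∂P + 2 * ∫ ω, (g' (F ω) / σ) * (D ω + w ω) ∂P at stein
  have hg1 : Integrable (fun ω => g (F ω)) P := by
    simpa using bdd hgc hgb (integrable_const (1 : ℝ))
  have hg'1 : Integrable (fun ω => g' (F ω)) P := by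
    simpa using bdd hg'c hg'b (integrable_const (1 : ℝ))
  have hgU := bdd hgc hgb hU1
  have hgV := bdd hgc hgb hV1
  have hg'S := bdd hg'c hg'b hS
  have e1 : ∫ ω, (D ω + w ω) * g (F ω) ∂P = ∫ ω, g (F ω) * (D ω - m) ∂P +
      ∫ ω, g (F ω) * (w ω - n) ∂P + (m + n) * ∫ ω, g (F ω) ∂P := by
    rw [← integral_const_mul, ← integral_add hgU hgV, ← integral_add]
    · refine integral_congr_ae (.of_forall fun ω => ?_)
      simp only
      ring
    · exact hgU.add hgV
    · exact hg1.const_mul _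
  have e2 : ∫ ω, (g' (F ω) / σ) * (D ω + w ω) ∂P = (∫ ω, g' (F ω) * (D ω + w ω) ∂P) / σ := by
    rw [← integral_div]
    refine integral_congr_ae (.of_forall fun ω => ?_)
    simp only
    ring
  have e3 : (∫ ω, h (F ω) ∂P) - c =
      (∫ ω, g' (F ω) ∂P) - (∫ ω, g (F ω) * (D ω - m) ∂P) / σ := by
    rw [← integral_div, ← integral_sub hg'1 (hgU.div_const σ)]
    have : ∀ ω, g' (F ω) - g (F ω) * (D ω - m) / σ = h (F ω) - c := fun ω => by
      rw [← heq (F ω), hF]; ring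
    simp_rw [this]
    rw [integral_sub hhi (integrable_const c)]
    simp
  have hg'T : Integrable (fun ω => g' (F ω) * (π * σ ^ 2 - (D ω + w ω))) P :=
    bdd hg'c hg'b ((integrable_const (π * σ ^ 2)).sub hS)
  have e4 : ∫ ω, g' (F ω) * (π * σ ^ 2 - (D ω + w ω)) ∂P =
      π * σ ^ 2 * (∫ ω, g' (F ω) ∂P) - ∫ ω, g' (F ω) * (D ω + w ω) ∂P := by
    rw [← integral_const_mul, ← integral_sub (hg'1.const_mul _) hg'S]
    refine integral_congr_ae (.of_forall fun ω => ?_)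
    simp only
    ring
  have e5 : π * σ ^ 2 * ((∫ ω, h (F ω) ∂P) - c) =
      ∫ ω, g' (F ω) * (π * σ ^ 2 - (D ω + w ω)) ∂P + π * σ * ∫ ω, g (F ω) * (w ω - n) ∂P := by
    rw [e1, e2] at stein
    rw [e3, e4]
    field_simp
    field_simp at stein
    linear_combination (-1 / 2) * stein + (1 / 2) * σ * (∫ ω, g (F ω) ∂P) * hES
  have b1 : |∫ ω, g (F ω) * (w ω - n) ∂P| ≤ 9 * s := by
    refine (abs_integral_le_integral_abs).trans
      ((integral_mono hgV.abs (hV1.abs.const_mul 9) fun ω => ?_).trans ?_)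
    · simp only [abs_mul]
      gcongr
      exact hgb _
    · rw [integral_const_mul]; gcongr
  have b2 : |∫ ω, g' (F ω) * (π * σ ^ 2 - (D ω + w ω)) ∂P| ≤ 2 * (π * (s * σ) + σ + s) := by
    refine (abs_integral_le_integral_abs).trans ((integral_mono hg'T.abs
      (((integrable_const (π * (s * σ))).add hUVi).const_mul 2)
        fun ω => ?_).trans ?_)
    · simp only [abs_mul, Pi.add_apply]
      gcongr
      · exact hg'b _
      · have : π * σ ^ 2 - (D ω + w ω) = (-(π * κ) - (D ω - m)) - (w ω - n) := by
          have : π * (2 * π * (σ ^ 2 + κ) - 2 * (m + n)) = 0 := by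
            linear_combination hvar - hES
          have := (mul_eq_zero.1 this).resolve_left hπ.ne'
          linear_combination (1 / 2) * this
        rw [this, ← add_assoc]
        refine (abs_sub _ _).trans (add_le_add_left ((abs_sub _ _).trans (add_le_add_left ?_ _)) _)
        rw [abs_neg, abs_mul, abs_of_pos hπ]
        gcongr
    · simp only [Pi.add_apply]
      rw [integral_const_mul, integral_add (integrable_const _) hUVi,
        integral_add hU1.abs hV1.abs]
      simp only [integral_const, probReal_univ, one_smul]
      linarith
  have b3 : π * σ ^ 2 * |(∫ ω, h (F ω) ∂P) - c| ≤ 2 * (π * (s * σ) + σ + s) + π * σ * (9 * s) := by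
    rw [← abs_of_pos (show 0 < π * σ ^ 2 by positivity), ← abs_mul, e5]
    refine (abs_add_le _ _).trans (add_le_add b2 ?_)
    rw [abs_mul, abs_of_pos (show 0 < π * σ by positivity)]
    gcongr
  have b4 : 2 * (π * (s * σ) + σ + s) + π * σ * (9 * s) ≤ π * σ * (11 * (1 + s)) := by
    have : σ ≤ π * σ := by nlinarith [Real.pi_gt_three]
    linarith
  have b5 : σ * |(∫ ω, h (F ω) ∂P) - c| ≤ 11 * (1 + s) := by
    have := b3.trans b4
    refine le_of_mul_le_mul_left (a := π * σ) ?_ (by positivity)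
    linarith
  rw [le_div_iff₀ hd']
  have := abs_nonneg ((∫ ω, h (F ω) ∂P) - c)
  calc |(∫ ω, h (F ω) ∂P) - c| * √d ≤ |(∫ ω, h (F ω) ∂P) - c| * (2 * π * σ) := by gcongr
    _ = 2 * π * (σ * |(∫ ω, h (F ω) ∂P) - c|) := by ring
    _ ≤ 2 * 4 * (11 * (1 + s)) := by gcongr; exact Real.pi_lt_four.le
    _ = 88 * (1 + s) := by ring

section Projection

variable {F : Type*} [NormedAddCommGroup F] [InnerProductSpace ℝ F]

theorem norm_sub_le_norm_sub_of_inner_nonpos {x p q : F} (h : (inner ℝ (x - p) (q - p)) ≤ 0) :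
    ‖x - p‖ ^ 2 ≤ ‖x - q‖ ^ 2 := by
  have : ‖x - q‖ ^ 2 = ‖x - p‖ ^ 2 - 2 * inner ℝ (x - p) (q - p) + ‖q - p‖ ^ 2 := by
    rw [← norm_sub_sq_real, sub_sub_sub_cancel_right]
  nlinarith [sq_nonneg ‖q - p‖]

/-- Existence of a continuous nearest-point map onto a complete convex set. -/
theorem exists_nearest_point_map {K : Set F} (hne : K.Nonempty) (hK : IsComplete K)
    (hconv : Convex ℝ K) :
    ∃ p : F → F, Continuous p ∧ (∀ x, p x ∈ K) ∧ (∀ x, infDist x K = ‖x - p x‖) ∧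
      ∀ x, ∀ q ∈ K, inner ℝ (x - p x) (q - p x) ≤ 0 := by
  choose p hpK hp using exists_norm_eq_iInf_of_complete_convex hne hK hconv
  have hin : ∀ x, ∀ q ∈ K, inner ℝ (x - p x) (q - p x) ≤ 0 := fun x =>
    (norm_eq_iInf_iff_real_inner_le_zero hconv (hpK x)).1 (hp x)
  refine ⟨p, ?_, hpK, fun x => ?_, hin⟩
  · refine (LipschitzWith.of_dist_le_mul (K := 1) fun x y => ?_).continuous
    rw [NNReal.coe_one, one_mul, dist_eq_norm, dist_eq_norm]
    have h1 := hin x _ (hpK y)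
    have h2 := hin y _ (hpK x)
    have h3 : ‖p x - p y‖ ^ 2 ≤ inner ℝ (x - y) (p x - p y) := by
      rw [← real_inner_self_eq_norm_sq]
      simp only [inner_sub_left, inner_sub_right] at h1 h2 ⊢
      linarith
    have h4 := real_inner_le_norm (x - y) (p x - p y)
    by_contra! hlt
    nlinarith [norm_nonneg (x - y)]
  · rw [infDist_eq_iInf, hp x]
    simp_rw [dist_eq_norm]

theorem hasDerivAt_norm_sub_sq_smul {p : F → F}
    (hin : ∀ x y, inner ℝ (x - p x) (p y - p x) ≤ 0) (x : F) (t : ℝ) :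
    HasDerivAt (fun t : ℝ => ‖t • x - p (t • x)‖ ^ 2) (2 * inner ℝ (t • x - p (t • x)) x) t := by
  have key : ∀ a b : F, ‖b - p b‖ ^ 2 ≤ ‖a - p a‖ ^ 2 + 2 * inner ℝ (a - p a) (b - a) + ‖b - a‖ ^ 2 := by
    intro a b
    refine (norm_sub_le_norm_sub_of_inner_nonpos (hin b a)).trans_eq ?_
    rw [← norm_add_sq_real]
    congr 2
    abel
  have key2 : ∀ a b : F, ‖a - p a‖ ^ 2 + 2 * inner ℝ (a - p a) (b - a) ≤ ‖b - p b‖ ^ 2 := by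
    intro a b
    have h1 := norm_add_sq_real (a - p a) ((b - p b) - (a - p a))
    rw [add_sub_cancel] at h1
    have h2 : (inner ℝ (a - p a) (b - p b - (a - p a))) = inner ℝ (a - p a) (b - a) - inner ℝ (a - p a) (p b - p a) := by
      rw [← inner_sub_right]
      congr 1
      abel
    nlinarith [hin a b, sq_nonneg ‖b - p b - (a - p a)‖]
  rw [hasDerivAt_iff_isLittleO]
  refine Asymptotics.IsBigO.trans_isLittleO (g := fun s => (s - t) ^ 2) ?_ ?_
  · refine Asymptotics.IsBigO.of_bound (‖x‖ ^ 2) (.of_forall fun s => ?_)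
    have h1 := key (t • x) (s • x)
    have h2 := key2 (t • x) (s • x)
    rw [← sub_smul, real_inner_smul_right] at h1 h2
    rw [norm_smul, mul_pow, Real.norm_eq_abs, sq_abs] at h1
    rw [Real.norm_eq_abs, Real.norm_eq_abs, abs_of_nonneg (sq_nonneg (s - t)), smul_eq_mul, abs_le]
    constructor <;> nlinarith [mul_nonneg (sq_nonneg ‖x‖) (sq_nonneg (s - t))]
  · simpa using Asymptotics.isLittleO_pow_sub_sub t one_lt_two

theorem norm_sub_sq_le_norm_sq {x q : F} (h : 0 ≤ inner ℝ (x - q) q) :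
    ‖x - q‖ ^ 2 + inner ℝ (x - q) q ≤ ‖x‖ ^ 2 := by
  have := norm_add_sq_real (x - q) q
  rw [sub_add_cancel] at this
  nlinarith [sq_nonneg ‖q‖]

end Projection

theorem half_norm_sq_sub_le_norm_sub_sq {F : Type*} [SeminormedAddCommGroup F] {x q : F} {R : ℝ} (h : ‖q‖ ≤ R) :
    ‖x‖ ^ 2 / 2 - R ^ 2 ≤ ‖x - q‖ ^ 2 := by
  have h1 : ‖x‖ ≤ ‖x - q‖ + R := by
    have := norm_add_le (x - q) q
    rw [sub_add_cancel] at this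
    linarith
  nlinarith [sq_nonneg (‖x - q‖ - R), norm_nonneg x]

theorem exp_neg_pi_mul_norm_sub_sq_le {F : Type*} [SeminormedAddCommGroup F] {x q : F} {R : ℝ} (h : ‖q‖ ≤ R) :
    exp (-π * ‖x - q‖ ^ 2) ≤ exp (π * R ^ 2) * exp (-(π / 2) * ‖x‖ ^ 2) := by
  rw [← exp_add]
  gcongr
  nlinarith [half_norm_sq_sub_le_norm_sub_sq h (x := x), pi_pos]

theorem two_add_sq_div_two_le_exp_add_exp_neg (t : ℝ) : 2 + t ^ 2 / 2 ≤ exp t + exp (-t) := by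
  rcases le_total 0 t with ht | ht
  · linarith [quadratic_le_exp_of_nonneg ht, add_one_le_exp (-t)]
  · have := quadratic_le_exp_of_nonneg (neg_nonneg.2 ht)
    linarith [add_one_le_exp t, neg_sq t]

theorem variance_le_of_mgf_mul_mgf_le {Ω : Type*} [MeasurableSpace Ω] {P : Measure Ω}
    [IsProbabilityMeasure P] {w : Ω → ℝ} (hw : MemLp w 2 P) {a M : ℝ} (ha : 0 < a)
    (h1 : Integrable (fun ω => exp (a * w ω)) P) (h2 : Integrable (fun ω => exp (-(a * w ω))) P)
    (h : (∫ ω, exp (a * w ω) ∂P) * ∫ ω, exp (-(a * w ω)) ∂P ≤ M) :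
    variance w P ≤ 4 * (M - 1) / a ^ 2 := by
  obtain ⟨n, hn⟩ : ∃ n, n = ∫ ω, w ω ∂P := ⟨_, rfl⟩
  have hw1 : Integrable w P := hw.integrable one_le_two
  have hv : MemLp (fun ω => w ω - n) 2 P := hw.sub (memLp_const n)
  have hz : ∫ ω, a * (w ω - n) ∂P = 0 := by
    rw [integral_const_mul, integral_sub hw1 (integrable_const _)]; simp [hn]
  have hvi : Integrable (fun ω => a * (w ω - n)) P := (hw1.sub (integrable_const n)).const_mul a
  have e1 : ∀ ω, exp (a * (w ω - n)) = exp (-(a * n)) * exp (a * w ω) := fun ω => by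
    rw [← exp_add]; ring_nf
  have e2 : ∀ ω, exp (-(a * (w ω - n))) = exp (a * n) * exp (-(a * w ω)) := fun ω => by
    rw [← exp_add]; ring_nf
  have i1 : Integrable (fun ω => exp (a * (w ω - n))) P := by
    simp_rw [e1]; exact h1.const_mul _
  have i2 : Integrable (fun ω => exp (-(a * (w ω - n)))) P := by
    simp_rw [e2]; exact h2.const_mul _
  obtain ⟨A, hA⟩ : ∃ A, A = ∫ ω, exp (a * (w ω - n)) ∂P := ⟨_, rfl⟩
  obtain ⟨B, hB⟩ : ∃ B, B = ∫ ω, exp (-(a * (w ω - n))) ∂P := ⟨_, rfl⟩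
  have hAB : A * B ≤ M := by
    refine le_of_eq_of_le ?_ h
    simp_rw [hA, hB, e1, e2, integral_const_mul]
    rw [mul_mul_mul_comm, ← exp_add, neg_add_cancel, exp_zero, one_mul]
  have hA1 : 1 ≤ A := by
    have := integral_mono (hvi.add (integrable_const 1)) i1 fun ω => add_one_le_exp _
    simp only [Pi.add_apply] at this
    rw [integral_add hvi (integrable_const _), hz, ← hA] at this
    simpa using this
  have hB1 : 1 ≤ B := by
    have := integral_mono (hvi.neg.add (integrable_const 1)) i2 fun ω => add_one_le_exp _
    simp only [Pi.add_apply, Pi.neg_apply] at this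
    rw [integral_add (by exact hvi.neg) (integrable_const _), integral_neg, hz, ← hB] at this
    simpa using this
  have hsum : 2 + a ^ 2 / 2 * variance w P ≤ A + B := by
    have := integral_mono ((integrable_const (2 : ℝ)).add (hv.integrable_sq.const_mul (a ^ 2 / 2)))
      (i1.add i2) fun ω => by
        simpa [mul_pow, mul_div_right_comm] using
          two_add_sq_div_two_le_exp_add_exp_neg (a * (w ω - n))
    simp only [Pi.add_apply] at this
    rw [integral_add (integrable_const _) (hv.integrable_sq.const_mul _), integral_add i1 i2,
      integral_const_mul, ← hA, ← hB] at this
    rw [variance_eq_integral hw.1.aemeasurable, ← hn]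
    simpa using this
  rw [le_div_iff₀ (by positivity)]
  nlinarith

section Gaussian

variable {E : Type*} [NormedAddCommGroup E] [InnerProductSpace ℝ E] [FiniteDimensional ℝ E]
  [MeasurableSpace E] [BorelSpace E]

theorem integrable_exp_neg_mul_sq_norm {b : ℝ} (hb : 0 < b) :
    Integrable fun x : E => exp (-b * ‖x‖ ^ 2) := by
  refine Integrable.of_integral_ne_zero ?_
  rw [GaussianFourier.integral_rexp_neg_mul_sq_norm hb]
  positivity

theorem integrable_of_abs_le_mul_exp_neg {Φ : E → ℝ} (hΦ : AEStronglyMeasurable Φ) {A b : ℝ}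
    (hA : 0 ≤ A) (hb : 0 < b) (h : ∀ x, |Φ x| ≤ A * ((1 + ‖x‖ ^ 2) ^ 2 * exp (-b * ‖x‖ ^ 2))) :
    Integrable Φ := by
  refine ((integrable_exp_neg_mul_sq_norm (E := E) (half_pos hb)).const_mul
    (A * (2 * exp (b / 2) * (2 / b) ^ 2))).mono' hΦ (.of_forall fun x => (h x).trans ?_)
  rw [mul_assoc]
  refine mul_le_mul_of_nonneg_left ?_ hA
  have h1 := pow_div_factorial_le_exp (x := b / 2 * (1 + ‖x‖ ^ 2)) (by positivity) 2
  have h2 : (1 + ‖x‖ ^ 2) ^ 2 ≤ 2 * (2 / b) ^ 2 * exp (b / 2 * (1 + ‖x‖ ^ 2)) := by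
    calc (1 + ‖x‖ ^ 2) ^ 2
        = 2 * (2 / b) ^ 2 * ((b / 2 * (1 + ‖x‖ ^ 2)) ^ 2 / (Nat.factorial 2 : ℕ)) := by
          simp [Nat.factorial]; field_simp
      _ ≤ _ := by gcongr
  calc (1 + ‖x‖ ^ 2) ^ 2 * exp (-b * ‖x‖ ^ 2)
      ≤ 2 * (2 / b) ^ 2 * exp (b / 2 * (1 + ‖x‖ ^ 2)) * exp (-b * ‖x‖ ^ 2) := by gcongr
    _ = 2 * (2 / b) ^ 2 * exp (b / 2 + -(b / 2) * ‖x‖ ^ 2) := by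
      rw [mul_assoc, ← exp_add]; ring_nf
    _ = _ := by rw [exp_add]; ring_nf

variable {p : E → E} {R : ℝ}

theorem integrable_mul_exp_neg_pi_mul_norm_sub_sq (hpc : Continuous p) (hpR : ∀ x, ‖p x‖ ≤ R)
    {Φ : E → ℝ} (hΦ : Continuous Φ) {A : ℝ} (h : ∀ x, |Φ x| ≤ A * (1 + ‖x‖ ^ 2) ^ 2) :
    Integrable fun x => Φ x * exp (-π * ‖x - p x‖ ^ 2) := by
  have hA : 0 ≤ A := by simpa using (abs_nonneg _).trans (h 0)
  refine integrable_of_abs_le_mul_exp_neg (A := A * exp (π * R ^ 2)) (b := π / 2)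
    (by fun_prop) (by positivity) (by positivity) fun x => ?_
  rw [abs_mul, abs_of_pos (exp_pos _)]
  calc |Φ x| * exp (-π * ‖x - p x‖ ^ 2)
      ≤ A * (1 + ‖x‖ ^ 2) ^ 2 * (exp (π * R ^ 2) * exp (-(π / 2) * ‖x‖ ^ 2)) := by
        gcongr
        · exact h x
        · exact exp_neg_pi_mul_norm_sub_sq_le (hpR x)
    _ = _ := by ring

/-- Integration by parts along dilations for functions of the squared distance to the range of a
nearest-point map `p`. -/
theorem finrank_mul_integral_comp_norm_sub_sq (hpc : Continuous p) (hpR : ∀ x, ‖p x‖ ≤ R)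
    (hin : ∀ x y, inner ℝ (x - p x) (p y - p x) ≤ 0) (h0 : ∀ x, 0 ≤ inner ℝ (x - p x) (p x)) {G G' : ℝ → ℝ}
    (hG : ∀ t, HasDerivAt G (G' t) t) (hG'c : Continuous G') {C : ℝ}
    (hGC : ∀ t, 0 ≤ t → |G t| ≤ C * (1 + t) * exp (-π * t))
    (hG'C : ∀ t, 0 ≤ t → |G' t| ≤ C * (1 + t) * exp (-π * t)) :
    Module.finrank ℝ E * ∫ x, G (‖x - p x‖ ^ 2) =
      -(2 * ∫ x, G' (‖x - p x‖ ^ 2) * (‖x - p x‖ ^ 2 + inner ℝ (x - p x) (p x))) := by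
  have hGc : Continuous G := continuous_iff_continuousAt.2 fun x => (hG x).continuousAt
  have hC : 0 ≤ C := by simpa using (abs_nonneg _).trans (hGC 0 le_rfl)
  have hD : ∀ x, ‖x - p x‖ ^ 2 ≤ ‖x‖ ^ 2 := fun x => by
    linarith [h0 x, norm_sub_sq_le_norm_sq (h0 x)]
  have hlow : ∀ x, ∀ t : ℝ, 1 / 2 ≤ t → exp (-π * ‖t • x - p (t • x)‖ ^ 2) ≤
      exp (π * R ^ 2) * exp (-(π / 8) * ‖x‖ ^ 2) := fun x t ht => by
    refine (exp_neg_pi_mul_norm_sub_sq_le (hpR _)).trans ?_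
    rw [norm_smul, mul_pow, Real.norm_eq_abs, sq_abs]
    gcongr ?_ * exp ?_
    have : (1 / 2) ^ 2 ≤ t ^ 2 := by gcongr
    nlinarith [mul_le_mul_of_nonneg_right this (sq_nonneg ‖x‖), pi_pos]
  have hF' : ∀ t ∈ Set.Ioo (1 / 2 : ℝ) 2, ∀ x,
      |G' (‖t • x - p (t • x)‖ ^ 2) * (2 * inner ℝ (t • x - p (t • x)) x)| ≤
        16 * C * exp (π * R ^ 2) * ((1 + ‖x‖ ^ 2) ^ 2 * exp (-(π / 8) * ‖x‖ ^ 2)) := by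
    intro t ht x
    have h1 : ‖t • x - p (t • x)‖ ^ 2 ≤ 4 * ‖x‖ ^ 2 := by
      refine (hD _).trans ?_
      rw [norm_smul, mul_pow, Real.norm_eq_abs, sq_abs]
      gcongr
      nlinarith [ht.1, ht.2]
    have h2 : |inner ℝ (t • x - p (t • x)) x| ≤ 2 * ‖x‖ ^ 2 := by
      refine (abs_real_inner_le_norm _ _).trans ?_
      have : ‖t • x - p (t • x)‖ ≤ 2 * ‖x‖ :=
        abs_le_of_sq_le_sq' (by linarith) (by positivity) |>.2
      nlinarith [norm_nonneg x]
    rw [abs_mul, abs_mul, abs_two]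
    calc |G' (‖t • x - p (t • x)‖ ^ 2)| * (2 * |inner ℝ (t • x - p (t • x)) x|)
        ≤ C * (1 + 4 * ‖x‖ ^ 2) * (exp (π * R ^ 2) * exp (-(π / 8) * ‖x‖ ^ 2)) *
          (2 * (2 * ‖x‖ ^ 2)) := by
          gcongr
          refine (hG'C _ (sq_nonneg _)).trans ?_
          gcongr
          exact hlow x t ht.1.le
      _ = C * exp (π * R ^ 2) * exp (-(π / 8) * ‖x‖ ^ 2) *
          ((1 + 4 * ‖x‖ ^ 2) * (4 * ‖x‖ ^ 2)) := by ring
      _ ≤ C * exp (π * R ^ 2) * exp (-(π / 8) * ‖x‖ ^ 2) * (16 * (1 + ‖x‖ ^ 2) ^ 2) := by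
          refine mul_le_mul_of_nonneg_left ?_ (by positivity)
          nlinarith [sq_nonneg ‖x‖]
      _ = _ := by ring
  have hmeas : ∀ t : ℝ, Continuous fun x : E => G (‖t • x - p (t • x)‖ ^ 2) := fun t => by
    fun_prop
  have hint : Integrable fun x : E => G (‖(1 : ℝ) • x - p ((1 : ℝ) • x)‖ ^ 2) := by
    refine integrable_of_abs_le_mul_exp_neg (A := C * exp (π * R ^ 2)) (b := π / 8)
      (hmeas 1).aestronglyMeasurable (by positivity) (by positivity) fun x => ?_
    calc _ ≤ C * (1 + ‖(1 : ℝ) • x - p ((1 : ℝ) • x)‖ ^ 2) *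
          exp (-π * ‖(1 : ℝ) • x - p ((1 : ℝ) • x)‖ ^ 2) := hGC _ (sq_nonneg _)
      _ ≤ C * (1 + ‖x‖ ^ 2) ^ 2 * (exp (π * R ^ 2) * exp (-(π / 8) * ‖x‖ ^ 2)) := by
          gcongr
          · rw [one_smul]
            nlinarith [hD x, sq_nonneg ‖x‖]
          · exact hlow x 1 (by norm_num)
      _ = _ := by ring
  have hderiv := (hasDerivAt_integral_of_dominated_loc_of_deriv_le
    (F := fun (t : ℝ) (x : E) => G (‖t • x - p (t • x)‖ ^ 2))
    (F' := fun t x => G' (‖t • x - p (t • x)‖ ^ 2) * (2 * inner ℝ (t • x - p (t • x)) x))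
    (μ := volume) (x₀ := (1 : ℝ)) (s := Set.Ioo (1 / 2) 2)
    (Ioo_mem_nhds (by norm_num) (by norm_num))
    (.of_forall fun t => (hmeas t).aestronglyMeasurable) hint
    (by apply Continuous.aestronglyMeasurable; fun_prop)
    (.of_forall fun x t ht => hF' t ht x)
    ((integrable_of_abs_le_mul_exp_neg (A := 16 * C * exp (π * R ^ 2)) (b := π / 8)
      (by apply Continuous.aestronglyMeasurable; fun_prop) (by positivity) (by positivity)
        fun x => (abs_of_nonneg (by positivity)).le))
    (.of_forall fun x t _ => (hG _).comp t (hasDerivAt_norm_sub_sq_smul hin x t))).2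
  have hscale : HasDerivAt (fun t : ℝ => ∫ x : E, G (‖t • x - p (t • x)‖ ^ 2))
      (-(Module.finrank ℝ E : ℝ) * ∫ x, G (‖x - p x‖ ^ 2)) 1 := by
    have h1 : HasDerivAt (fun t : ℝ => (t ^ Module.finrank ℝ E)⁻¹ * ∫ x, G (‖x - p x‖ ^ 2))
        (-(Module.finrank ℝ E : ℝ) * ∫ x, G (‖x - p x‖ ^ 2)) 1 := by
      simpa using ((hasDerivAt_pow (Module.finrank ℝ E) (1 : ℝ)).fun_inv (by simp)).mul_const
        (∫ x, G (‖x - p x‖ ^ 2))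
    refine h1.congr_of_eventuallyEq ?_
    filter_upwards [Ioi_mem_nhds (zero_lt_one' ℝ)] with t ht
    exact Measure.integral_comp_smul_of_nonneg volume (fun x => G (‖x - p x‖ ^ 2)) t
      (hR := ht.le)
  have := hderiv.unique hscale
  have e : ∀ x : E, inner ℝ (x - p x) x = ‖x - p x‖ ^ 2 + inner ℝ (x - p x) (p x) := fun x => by
    rw [← real_inner_self_eq_norm_sq, ← inner_add_right, sub_add_cancel]
  simp only [one_smul, e, mul_left_comm _ (2 : ℝ), integral_const_mul] at this
  linarith

theorem two_pi_mul_integral_mul_comp_norm_sub_sq (hpc : Continuous p) (hpR : ∀ x, ‖p x‖ ≤ R)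
    (hin : ∀ x y, inner ℝ (x - p x) (p y - p x) ≤ 0) (h0 : ∀ x, 0 ≤ inner ℝ (x - p x) (p x)) {f f' : ℝ → ℝ}
    (hf : ∀ t, HasDerivAt f (f' t) t) (hf'c : Continuous f') {B : ℝ} (hB : ∀ t, |f' t| ≤ B) :
    2 * π * ∫ x, (‖x - p x‖ ^ 2 + inner ℝ (x - p x) (p x)) * f (‖x - p x‖ ^ 2) *
        exp (-π * ‖x - p x‖ ^ 2) =
      Module.finrank ℝ E * (∫ x, f (‖x - p x‖ ^ 2) * exp (-π * ‖x - p x‖ ^ 2)) +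
        2 * ∫ x, f' (‖x - p x‖ ^ 2) * (‖x - p x‖ ^ 2 + inner ℝ (x - p x) (p x)) *
          exp (-π * ‖x - p x‖ ^ 2) := by
  have hfc : Continuous f := continuous_iff_continuousAt.2 fun x => (hf x).continuousAt
  have hB0 : 0 ≤ B := (abs_nonneg _).trans (hB 0)
  have hfB : ∀ t, 0 ≤ t → |f t| ≤ (|f 0| + B) * (1 + t) := fun t ht => by
    have h1 := convex_univ.norm_image_sub_le_of_norm_hasDerivWithin_le (f := f) (f' := f') (C := B)
      (fun x _ => (hf x).hasDerivWithinAt) (fun x _ => hB x) (Set.mem_univ 0) (Set.mem_univ t)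
    rw [sub_zero, Real.norm_eq_abs, Real.norm_eq_abs, abs_of_nonneg ht] at h1
    have h2 := abs_sub_abs_le_abs_sub (f t) (f 0)
    nlinarith [mul_nonneg (abs_nonneg (f 0)) ht]
  have hS0 : ∀ x, 0 ≤ ‖x - p x‖ ^ 2 + inner ℝ (x - p x) (p x) := fun x => add_nonneg (sq_nonneg _) (h0 x)
  have hS : ∀ x, ‖x - p x‖ ^ 2 + inner ℝ (x - p x) (p x) ≤ ‖x‖ ^ 2 := fun x => norm_sub_sq_le_norm_sq (h0 x)
  have hD : ∀ x, ‖x - p x‖ ^ 2 ≤ ‖x‖ ^ 2 := fun x => by linarith [h0 x, hS x]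
  have i1 : Integrable fun x => f' (‖x - p x‖ ^ 2) * (‖x - p x‖ ^ 2 + inner ℝ (x - p x) (p x)) *
      exp (-π * ‖x - p x‖ ^ 2) := by
    refine integrable_mul_exp_neg_pi_mul_norm_sub_sq hpc hpR (by fun_prop) (A := B) fun x => ?_
    rw [abs_mul, abs_of_nonneg (hS0 x)]
    refine mul_le_mul (hB _) ?_ (hS0 x) hB0
    nlinarith [hS x, sq_nonneg ‖x‖]
  have i2 : Integrable fun x => (‖x - p x‖ ^ 2 + inner ℝ (x - p x) (p x)) * f (‖x - p x‖ ^ 2) *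
      exp (-π * ‖x - p x‖ ^ 2) := by
    refine integrable_mul_exp_neg_pi_mul_norm_sub_sq hpc hpR (by fun_prop) (A := |f 0| + B)
      fun x => ?_
    rw [abs_mul, abs_of_nonneg (hS0 x)]
    calc (‖x - p x‖ ^ 2 + inner ℝ (x - p x) (p x)) * |f (‖x - p x‖ ^ 2)|
        ≤ (1 + ‖x‖ ^ 2) * ((|f 0| + B) * (1 + ‖x‖ ^ 2)) := by
          refine mul_le_mul (by linarith [hS x]) ((hfB _ (sq_nonneg _)).trans ?_) (abs_nonneg _)
            (by positivity)
          exact mul_le_mul_of_nonneg_left (by linarith [hD x]) (by positivity)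
      _ = _ := by ring
  have key := finrank_mul_integral_comp_norm_sub_sq hpc hpR hin h0
    (G := fun t => f t * exp (-π * t)) (G' := fun t => f' t * exp (-π * t) +
      f t * (exp (-π * t) * -π)) (C := B + π * (|f 0| + B))
    (fun t => (hf t).mul (by simpa using ((hasDerivAt_id t).const_mul (-π)).exp))
    (by fun_prop)
    (fun t ht => by
      rw [abs_mul, abs_of_pos (exp_pos _)]
      gcongr
      refine (hfB t ht).trans (mul_le_mul_of_nonneg_right ?_ (by positivity))
      nlinarith [pi_gt_three, abs_nonneg (f 0)])
    (fun t ht => by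
      have : f' t * exp (-π * t) + f t * (exp (-π * t) * -π) = (f' t - π * f t) * exp (-π * t) := by
        ring
      rw [this, abs_mul, abs_of_pos (exp_pos _)]
      gcongr
      refine (abs_sub _ _).trans ?_
      rw [abs_mul, abs_of_pos pi_pos]
      have := mul_le_mul_of_nonneg_left (hfB t ht) pi_pos.le
      nlinarith [hB t])
  have e : ∀ x, (f' (‖x - p x‖ ^ 2) * exp (-π * ‖x - p x‖ ^ 2) +
      f (‖x - p x‖ ^ 2) * (exp (-π * ‖x - p x‖ ^ 2) * -π)) *
        (‖x - p x‖ ^ 2 + inner ℝ (x - p x) (p x)) =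
      f' (‖x - p x‖ ^ 2) * (‖x - p x‖ ^ 2 + inner ℝ (x - p x) (p x)) * exp (-π * ‖x - p x‖ ^ 2) -
      π * ((‖x - p x‖ ^ 2 + inner ℝ (x - p x) (p x)) * f (‖x - p x‖ ^ 2) *
        exp (-π * ‖x - p x‖ ^ 2)) := fun x => by ring
  simp_rw [e] at key
  rw [integral_sub i1 (i2.const_mul π), integral_const_mul] at key
  linarith

theorem integrable_exp_mul_exp_neg_pi_mul_norm_sub_sq (hpc : Continuous p)
    (hpR : ∀ x, ‖p x‖ ≤ R) (h0 : ∀ x, 0 ≤ inner ℝ (x - p x) (p x)) (a : ℝ) :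
    Integrable fun x => exp (a * inner ℝ (x - p x) (p x)) * exp (-π * ‖x - p x‖ ^ 2) := by
  have hR : 0 ≤ R := (norm_nonneg _).trans (hpR 0)
  have hπ := pi_pos
  refine integrable_of_abs_le_mul_exp_neg
    (A := exp (π * R ^ 2) * exp ((|a| * R) ^ 2 / π)) (b := π / 4)
    (by apply Continuous.aestronglyMeasurable; fun_prop) (by positivity) (by positivity)
    fun x => ?_
  rw [abs_of_pos (by positivity)]
  have h1 : (inner ℝ (x - p x) (p x)) ≤ ‖x‖ * R := by
    refine (real_inner_le_norm _ _).trans ?_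
    gcongr
    · refine abs_le_of_sq_le_sq' ?_ (norm_nonneg x) |>.2
      linarith [norm_sub_sq_le_norm_sq (h0 x), h0 x]
    · exact hpR x
  have h2 : a * inner ℝ (x - p x) (p x) ≤ (|a| * R) ^ 2 / π + π / 4 * ‖x‖ ^ 2 := by
    calc a * inner ℝ (x - p x) (p x) ≤ |a| * (‖x‖ * R) :=
          mul_le_mul (le_abs_self a) h1 (h0 x) (abs_nonneg a)
      _ ≤ _ := by
        have : 0 ≤ (|a| * R - π / 2 * ‖x‖) ^ 2 / π := by positivity
        have e : (|a| * R - π / 2 * ‖x‖) ^ 2 / π =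
            (|a| * R) ^ 2 / π + π / 4 * ‖x‖ ^ 2 - |a| * (‖x‖ * R) := by
          field_simp
          ring
        linarith
  calc exp (a * inner ℝ (x - p x) (p x)) * exp (-π * ‖x - p x‖ ^ 2)
      ≤ exp ((|a| * R) ^ 2 / π + π / 4 * ‖x‖ ^ 2) *
        (exp (π * R ^ 2) * exp (-(π / 2) * ‖x‖ ^ 2)) := by
        gcongr
        exact exp_neg_pi_mul_norm_sub_sq_le (hpR x)
    _ = exp (π * R ^ 2) * exp ((|a| * R) ^ 2 / π) * (1 * exp (-(π / 4) * ‖x‖ ^ 2)) := by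
        rw [one_mul]
        simp only [← exp_add]
        ring_nf
    _ ≤ _ := by
        gcongr
        exact one_le_pow₀ (by nlinarith [sq_nonneg ‖x‖])

theorem integral_exp_mul_integral_exp_neg_le {d : ℕ} {K : Set (EuclideanSpace ℝ (Fin d))}
    (hconv : Convex ℝ K) {p : EuclideanSpace ℝ (Fin d) → EuclideanSpace ℝ (Fin d)} {R : ℝ}
    (hpc : Continuous p) (hpK : ∀ x, p x ∈ K) (hpR : ∀ x, ‖p x‖ ≤ R)
    (hin : ∀ x, ∀ q ∈ K, inner ℝ (x - p x) (q - p x) ≤ 0) (h0 : ∀ x, 0 ≤ inner ℝ (x - p x) (p x)) {s : ℝ}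
    (hs0 : 0 ≤ s) (hs1 : s ≤ 1) :
    (∫ x, exp (2 * π * s * inner ℝ (x - p x) (p x)) * exp (-π * ‖x - p x‖ ^ 2)) *
      (∫ x, exp (-(2 * π * s * inner ℝ (x - p x) (p x))) * exp (-π * ‖x - p x‖ ^ 2)) ≤
      exp (2 * π * (s * R) ^ 2) * (∫ x, exp (-π * ‖x - p x‖ ^ 2)) ^ 2 := by
  have i1 := integrable_exp_mul_exp_neg_pi_mul_norm_sub_sq hpc hpR h0 (2 * π * s)
  have i2 := integrable_exp_mul_exp_neg_pi_mul_norm_sub_sq hpc hpR h0 (-(2 * π * s))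
  have i3 := integrable_exp_mul_exp_neg_pi_mul_norm_sub_sq hpc hpR h0 0
  simp only [neg_mul (2 * π * s)] at i2
  simp only [zero_mul, exp_zero, one_mul] at i3
  have hpl := prekopa_leindler_euclideanSpace
    (f := fun x => .ofReal (exp (2 * π * s * inner ℝ (x - p x) (p x)) * exp (-π * ‖x - p x‖ ^ 2)))
    (g := fun x => .ofReal (exp (-(2 * π * s * inner ℝ (x - p x) (p x))) * exp (-π * ‖x - p x‖ ^ 2)))
    (h := fun x => .ofReal (exp (π * (s * R) ^ 2) * exp (-π * ‖x - p x‖ ^ 2)))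
    (by fun_prop) (by fun_prop) (by fun_prop) fun x y => by
      set z := midpoint ℝ x y with hz
      rw [← ENNReal.ofReal_mul (by positivity), ← ENNReal.ofReal_pow (by positivity)]
      apply ENNReal.ofReal_le_ofReal
      rw [← exp_add, ← exp_add, ← exp_add, ← exp_add, ← exp_nat_mul, exp_le_exp]
      have hq : ((1 + s) / 2) • p x + ((1 - s) / 2) • p y ∈ K :=
        hconv (hpK x) (hpK y) (by linarith) (by linarith) (by ring)
      have h1 := norm_sub_le_norm_sub_of_inner_nonpos (hin z _ hq)
      have h2 : z - (((1 + s) / 2) • p x + ((1 - s) / 2) • p y) =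
          (1 / 2 : ℝ) • ((x - p x - s • p x) + (y - p y + s • p y)) := by
        rw [hz, midpoint_eq_smul_add, invOf_eq_inv]
        module
      have h3 := parallelogram_law_with_norm ℝ (x - p x - s • p x) (y - p y + s • p y)
      have h4 : 2 * ‖z - p z‖ ^ 2 ≤ ‖x - p x - s • p x‖ ^ 2 + ‖y - p y + s • p y‖ ^ 2 := by
        rw [h2, norm_smul, mul_pow] at h1
        norm_num at h1
        nlinarith [sq_nonneg ‖(x - p x - s • p x) - (y - p y + s • p y)‖]
      have h5 : ∀ u, ‖s • p u‖ ^ 2 ≤ (s * R) ^ 2 := fun u => by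
        rw [norm_smul, Real.norm_eq_abs, abs_of_nonneg hs0]
        have := hpR u
        gcongr
      rw [norm_sub_sq_real (x - p x), norm_add_sq_real (y - p y), real_inner_smul_right,
        real_inner_smul_right] at h4
      have h6 := mul_le_mul_of_nonneg_left (h4.trans (add_le_add (add_le_add_right (h5 x) _)
        (add_le_add_right (h5 y) _))) pi_pos.le
      push_cast
      linarith
  rw [← ofReal_integral_eq_lintegral_ofReal i1 (.of_forall fun _ => by positivity),
    ← ofReal_integral_eq_lintegral_ofReal i2 (.of_forall fun _ => by positivity),
    ← ofReal_integral_eq_lintegral_ofReal (i3.const_mul _) (.of_forall fun _ => by positivity),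
    ← ENNReal.ofReal_mul (integral_nonneg fun _ => by positivity),
    ← ENNReal.ofReal_pow (integral_nonneg fun _ => by positivity),
    ENNReal.ofReal_le_ofReal_iff (by positivity), integral_const_mul, mul_pow, ← exp_nat_mul] at hpl
  refine hpl.trans_eq ?_
  push_cast
  ring_nf

end Gaussian

theorem abs_integral_infDist_sub_gaussian_le {d : ℕ} (hd : 1 ≤ d)
    {K : Set (EuclideanSpace ℝ (Fin d))} (hK : IsCompact K) (hconv : Convex ℝ K) (hK0 : 0 ∈ K)
    {R : ℝ} (hR : ∀ q ∈ K, ‖q‖ ≤ R) {Ω : Type*} [MeasurableSpace Ω] {P : Measure Ω}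
    [IsProbabilityMeasure P] {X : Ω → EuclideanSpace ℝ (Fin d)} (hX : Measurable X)
    (hlaw : P.map X = volume.withDensity fun x =>
      .ofReal (exp (-π * infDist x K ^ 2) / ∫ y, exp (-π * infDist y K ^ 2)))
    {h : ℝ → ℝ} (hc : Continuous h) (h0 : ∀ x, 0 ≤ h x) (h1 : ∀ x, h x ≤ 1) :
    |(∫ ω, h ((infDist (X ω) K ^ 2 - ∫ ω', infDist (X ω') K ^ 2 ∂P) /
      √(variance (fun ω' => infDist (X ω') K ^ 2) P)) ∂P) - ∫ y, h y ∂gaussianReal 0 1| ≤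
      88 * (1 + exp π * (1 + R)) / √d := by
  obtain ⟨p, hpc, hpK, hpd, hin⟩ := exists_nearest_point_map ⟨0, hK0⟩ hK.isComplete hconv
  have hpR : ∀ x, ‖p x‖ ≤ R := fun x => hR _ (hpK x)
  have hR0 : 0 ≤ R := (norm_nonneg _).trans (hpR 0)
  have hp0 : ∀ x, 0 ≤ inner ℝ (x - p x) (p x) := fun x => by simpa using hin x 0 hK0
  simp_rw [hpd] at hlaw ⊢
  have i0 : Integrable fun x : EuclideanSpace ℝ (Fin d) => exp (-π * ‖x - p x‖ ^ 2) := by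
    simpa using integrable_exp_mul_exp_neg_pi_mul_norm_sub_sq hpc hpR hp0 0
  have hZ : 0 < ∫ x, exp (-π * ‖x - p x‖ ^ 2) := integral_exp_pos i0
  obtain ⟨Z, hZdef⟩ : ∃ Z, Z = ∫ x, exp (-π * ‖x - p x‖ ^ 2) := ⟨_, rfl⟩
  rw [← hZdef] at hlaw hZ
  have hρ : Measurable fun x => ENNReal.ofReal (exp (-π * ‖x - p x‖ ^ 2) / Z) := by fun_prop
  have hE : ∀ Φ : EuclideanSpace ℝ (Fin d) → ℝ, Continuous Φ →
      ∫ ω, Φ (X ω) ∂P = (∫ x, Φ x * exp (-π * ‖x - p x‖ ^ 2)) / Z := fun Φ hΦ => by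
    rw [← integral_map hX.aemeasurable hΦ.aestronglyMeasurable, hlaw,
      integral_withDensity_eq_integral_toReal_smul hρ (by simp), ← integral_div]
    refine integral_congr_ae (.of_forall fun x => ?_)
    simp only [smul_eq_mul]
    rw [ENNReal.toReal_ofReal (by positivity)]
    ring
  have hI : ∀ Φ : EuclideanSpace ℝ (Fin d) → ℝ, Continuous Φ →
      Integrable (fun x => Φ x * exp (-π * ‖x - p x‖ ^ 2)) → Integrable (fun ω => Φ (X ω)) P := by
    intro Φ hΦ hΦi
    have : Integrable Φ (P.map X) := by
      rw [hlaw, integrable_withDensity_iff_integrable_smul' hρ (by simp)]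
      refine (hΦi.div_const Z).congr (.of_forall fun x => ?_)
      simp only [smul_eq_mul]
      rw [ENNReal.toReal_ofReal (by positivity)]
      ring
    exact this.comp_measurable hX
  have hS : ∀ x, ‖x - p x‖ ^ 2 + inner ℝ (x - p x) (p x) ≤ ‖x‖ ^ 2 := fun x =>
    norm_sub_sq_le_norm_sq (hp0 x)
  have hsq : ∀ Φ : EuclideanSpace ℝ (Fin d) → ℝ, Continuous Φ → (∀ x, 0 ≤ Φ x) →
      (∀ x, Φ x ≤ ‖x‖ ^ 2) → MemLp (fun ω => Φ (X ω)) 2 P := fun Φ hΦ hΦ0 hΦ1 => by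
    refine (memLp_two_iff_integrable_sq (hΦ.measurable.comp hX).aestronglyMeasurable).2
      (hI (fun x => Φ x ^ 2) (by fun_prop) (integrable_mul_exp_neg_pi_mul_norm_sub_sq hpc hpR
        (by fun_prop) (A := 1) fun x => ?_))
    rw [abs_of_nonneg (sq_nonneg _), one_mul]
    have := hΦ0 x
    gcongr
    linarith [hΦ1 x]
  have hD2 : MemLp (fun ω => ‖X ω - p (X ω)‖ ^ 2) 2 P :=
    hsq (fun x => ‖x - p x‖ ^ 2) (by fun_prop) (fun x => by positivity)
      fun x => by linarith [hS x, hp0 x]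
  have hw2 : MemLp (fun ω => inner ℝ (X ω - p (X ω)) (p (X ω))) 2 P :=
    hsq (fun x => inner ℝ (x - p x) (p x)) (by fun_prop) hp0
      fun x => by linarith [hS x, sq_nonneg ‖x - p x‖]
  refine abs_integral_sub_gaussian_le (D := fun ω => ‖X ω - p (X ω)‖ ^ 2)
    (w := fun ω => inner ℝ (X ω - p (X ω)) (p (X ω))) (by fun_prop) hD2 hw2 (by positivity)
    (by positivity) ?_ ?_ hc h0 h1
  · have hs1 : 1 / (1 + R) ≤ 1 := by rw [div_le_one (by positivity)]; linarith
    have hmgf := integral_exp_mul_integral_exp_neg_le hconv hpc hpK hpR hin hp0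
      (s := 1 / (1 + R)) (by positivity) hs1
    have hi1 := integrable_exp_mul_exp_neg_pi_mul_norm_sub_sq hpc hpR hp0 (2 * π * (1 / (1 + R)))
    have hi2 := integrable_exp_mul_exp_neg_pi_mul_norm_sub_sq hpc hpR hp0
      (-(2 * π * (1 / (1 + R))))
    simp only [neg_mul (2 * π * (1 / (1 + R)))] at hi2
    have hv := variance_le_of_mgf_mul_mgf_le hw2 (a := 2 * π * (1 / (1 + R))) (M := exp (2 * π))
      (by positivity)
      (hI (fun x => exp (2 * π * (1 / (1 + R)) * inner ℝ (x - p x) (p x))) (by fun_prop) hi1)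
      (hI (fun x => exp (-(2 * π * (1 / (1 + R)) * inner ℝ (x - p x) (p x)))) (by fun_prop) hi2)
      (by
        rw [hE (fun x => exp (2 * π * (1 / (1 + R)) * inner ℝ (x - p x) (p x))) (by fun_prop),
          hE (fun x => exp (-(2 * π * (1 / (1 + R)) * inner ℝ (x - p x) (p x)))) (by fun_prop),
          div_mul_div_comm, div_le_iff₀ (by positivity)]
        refine hmgf.trans ?_
        rw [← hZdef, sq Z]
        refine mul_le_mul_of_nonneg_right (exp_le_exp.2 ?_) (by positivity)
        have : (1 / (1 + R) * R) ^ 2 ≤ 1 := by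
          refine pow_le_one₀ (by positivity) ?_
          rw [one_div_mul_eq_div, div_le_one (by positivity)]
          linarith
        nlinarith [pi_pos])
    refine hv.trans ?_
    rw [div_le_iff₀ (by positivity)]
    have e : (exp π * (1 + R)) ^ 2 * (2 * π * (1 / (1 + R))) ^ 2 = 4 * π ^ 2 * exp (2 * π) := by
      rw [mul_comm 2 π, exp_mul]
      field_simp
      norm_num
      ring
    rw [e]
    have : 1 ≤ π ^ 2 := one_le_pow₀ (by linarith [pi_gt_three])
    nlinarith [mul_nonneg (sub_nonneg.2 this) (exp_pos (2 * π)).le]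
  · rintro f f' hf hf'c ⟨B, hB⟩
    have hfc : Continuous f := continuous_iff_continuousAt.2 fun x => (hf x).continuousAt
    have := two_pi_mul_integral_mul_comp_norm_sub_sq hpc hpR (fun x y => hin x _ (hpK y)) hp0
      hf hf'c hB
    rw [finrank_euclideanSpace_fin] at this
    rw [hE (fun x => (‖x - p x‖ ^ 2 + inner ℝ (x - p x) (p x)) * f (‖x - p x‖ ^ 2))
        (by fun_prop), hE (fun x => f (‖x - p x‖ ^ 2)) (by fun_prop),
      hE (fun x => f' (‖x - p x‖ ^ 2) * (‖x - p x‖ ^ 2 + inner ℝ (x - p x) (p x))) (by fun_prop),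
      ← mul_div_assoc, ← mul_div_assoc, ← mul_div_assoc, ← add_div, this]

theorem map_sub_const_eq_withDensity {d : ℕ} {Ω : Type*} [MeasurableSpace Ω] {P : Measure Ω}
    {X : Ω → EuclideanSpace ℝ (Fin d)} (hX : Measurable X)
    {ρ : EuclideanSpace ℝ (Fin d) → ℝ≥0∞} (hlaw : P.map X = volume.withDensity ρ) (v : EuclideanSpace ℝ (Fin d)) :
    P.map (fun ω => X ω - v) = volume.withDensity fun x => ρ (x + v) := by
  have hm : Measurable fun x : EuclideanSpace ℝ (Fin d) => x - v := by fun_prop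
  ext s hs
  rw [← Function.comp_def (fun x => x - v) X, ← Measure.map_map hm hX, hlaw, Measure.map_apply hm hs,
    withDensity_apply _ (hm hs), withDensity_apply _ hs,
    ← lintegral_indicator (hm hs), ← lintegral_indicator hs,
    ← lintegral_add_right_eq_self _ v]
  refine lintegral_congr fun x => ?_
  classical
  rw [Set.indicator_apply, Set.indicator_apply]
  exact if_congr (by rw [Set.mem_preimage, add_sub_cancel_right]) rfl rfl

theorem main_tv_bound (α : ℝ) (hα : 0 ≤ α) (c : ℝ) (hc : 0 < c) :
    ∃ C : ℝ, ∀ (d : ℕ), 1 ≤ d →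
      ∀ K : Set (EuclideanSpace ℝ (Fin d)),
        IsCompact K → Convex ℝ K → (interior K).Nonempty →
        Metric.diam K ≤ 2 * c * (d : ℝ) ^ α →
        ∀ (Ω : Type) (_ : MeasurableSpace Ω) (P : Measure Ω), IsProbabilityMeasure P →
        ∀ X : Ω → EuclideanSpace ℝ (Fin d), Measurable X →
          Measure.map X P = volume.withDensity (fun x =>
            ENNReal.ofReal (Real.exp (-π * Metric.infDist x K ^ 2) /
              ∫ y : EuclideanSpace ℝ (Fin d), Real.exp (-π * Metric.infDist y K ^ 2))) →
          dTV
            (Measure.map (fun ω =>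
              (Metric.infDist (X ω) K ^ 2 - ∫ ω', Metric.infDist (X ω') K ^ 2 ∂P) /
                Real.sqrt (variance (fun ω' => Metric.infDist (X ω') K ^ 2) P)) P)
            (gaussianReal 0 1) ≤ C * (d : ℝ) ^ (α - 1/2) := by
  refine ⟨88 * (1 + exp π * (1 + 2 * c)), fun d hd K hK hconv hne hdiam Ω _ P _ X hX hlaw => ?_⟩
  obtain ⟨v, hv⟩ := hne.mono interior_subset
  have hd1 : (1 : ℝ) ≤ d := by exact_mod_cast hd
  have hdα : 1 ≤ (d : ℝ) ^ α := one_le_rpow hd1 hα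
  have hbound : 88 * (1 + exp π * (1 + 2 * c * (d : ℝ) ^ α)) / √d ≤
      88 * (1 + exp π * (1 + 2 * c)) * (d : ℝ) ^ (α - 1 / 2) := by
    rw [rpow_sub (by positivity), ← sqrt_eq_rpow, ← mul_div_assoc]
    refine div_le_div_of_nonneg_right ?_ (sqrt_nonneg _)
    nlinarith [mul_nonneg (exp_pos π).le (sub_nonneg.2 hdα)]
  have himage : ∀ x, infDist (x - v) ((fun q => q - v) '' K) = infDist x K := fun x =>
    infDist_image (Φ := fun q => q - v) (IsometryEquiv.subRight v).isometry
  have hF : Measurable fun ω => (infDist (X ω) K ^ 2 - ∫ ω', infDist (X ω') K ^ 2 ∂P) /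
      √(variance (fun ω' => infDist (X ω') K ^ 2) P) := by fun_prop
  have := Measure.isProbabilityMeasure_map (μ := P) hF.aemeasurable
  refine ciSup_le fun A => ?_
  refine abs_measureReal_sub_le_of_forall_continuous (fun h hc h0 h1 => ?_) A.2
  refine le_trans ?_ hbound
  rw [integral_map hF.aemeasurable hc.aestronglyMeasurable]
  have hlaw' := map_sub_const_eq_withDensity hX hlaw v
  have hZ : ∫ y, exp (-π * infDist y ((fun q => q - v) '' K) ^ 2) =
      ∫ y, exp (-π * infDist y K ^ 2) := by
    rw [← integral_sub_right_eq_self _ v]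
    simp_rw [himage]
  have key := abs_integral_infDist_sub_gaussian_le (K := (fun q => q - v) '' K) hd
    (hK.image (by fun_prop)) (by simpa [sub_eq_add_neg] using hconv.translate_preimage_left v)
    ⟨v, hv, sub_self v⟩ (R := 2 * c * (d : ℝ) ^ α)
    (by
      rintro _ ⟨q, hq, rfl⟩
      rw [← dist_eq_norm]
      exact (dist_le_diam_of_mem hK.isBounded hq hv).trans hdiam)
    (X := fun ω => X ω - v) (by fun_prop)
    (by
      rw [hlaw', hZ]
      simp_rw [← himage (_ + v), add_sub_cancel_right]) hc h0 h1
  simpa only [himage] using key
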